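/- arXiv:2308.02753 — 4 statements merged into one kernel-verified Lean document; each statement's English description precedes it below -/
import Mathlib

section
/- Let n, B, M be positive natural numbers, let θ ∈ ℝⁿ (Euclidean space), let η ∈ ℝ, let ℓ_i : ℝⁿ → ℝ for i ∈ Fin B be per-training-instance loss functions that are differentiable at θ, and let g_j : ℝⁿ → ℝ for j ∈ Fin M be per-validation-instance loss functions. Let σ : ℝ → ℝ be the logistic sigmoid σ(t) = (1 + exp(−t))⁻¹, define the virtually updated parameters θ̂ : ℝ^B → ℝⁿ by θ̂(w) = θ − (η/B) · Σ_{i∈Fin B} σ(w_i) · ∇ℓ_i(θ), and define the meta validation loss L_M : ℝⁿ → ℝ by L_M(θ') = (1/M) · Σ_{j∈Fin M} g_j(θ'). If each g_j is differentiable at θ̂(w), then for every i ∈ Fin B the partial derivative of the map w ↦ L_M(θ̂(w)) with respect to the coordinate w_i, evaluated at w, equals −(η/B) · σ(w_i) · (1 − σ(w_i)) · ⟪(1/M) · Σ_{j∈Fin M} ∇g_j(θ̂(w)), ∇ℓ_i(θ)⟫, the negative of the scaled inner product between the average gradient of the validation losses at θ̂(w) and the gradient of the i-th training loss at θ. -/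
open scoped RealInnerProductSpace BigOperators

/-- A scaled finite sum of differentiable functions has the scaled sum of the gradients as its
gradient. -/
theorem hasGradientAt_const_mul_sum {ι E : Type*} [NormedAddCommGroup E] [InnerProductSpace ℝ E]
    [CompleteSpace E] (s : Finset ι) (c : ℝ) {g : ι → E → ℝ} {x : E}
    (hg : ∀ j ∈ s, DifferentiableAt ℝ (g j) x) :
    HasGradientAt (fun y => c * ∑ j ∈ s, g j y) (c • ∑ j ∈ s, gradient (g j) x) x := by
  rw [hasGradientAt_iff_hasFDerivAt, map_smul, map_sum]
  exact (HasFDerivAt.fun_sum fun j hj => (hg j hj).hasGradientAt.hasFDerivAt).const_mul c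

/-- The chain rule for a function with a gradient along a differentiable curve. -/
theorem HasGradientAt.comp_hasDerivAt_inner {E : Type*} [NormedAddCommGroup E]
    [InnerProductSpace ℝ E] [CompleteSpace E] {f : E → ℝ} {f' v : E} {γ : ℝ → E} {t : ℝ}
    (hf : HasGradientAt f f' (γ t)) (hγ : HasDerivAt γ v t) :
    HasDerivAt (fun s => f (γ s)) ⟪f', v⟫ t := by
  simpa [Function.comp_def] using hf.hasFDerivAt.comp_hasDerivAt t hγ

/-- The derivative of a weighted sum of vectors with respect to the `i`-th weight parameter. -/
theorem hasDerivAt_sum_update_smul {ι E : Type*} [Fintype ι] [DecidableEq ι]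
    [NormedAddCommGroup E] [NormedSpace ℝ E] {φ : ℝ → ℝ} {φ' : ℝ} (w : ι → ℝ) (i : ι)
    (hφ : HasDerivAt φ φ' (w i)) (v : ι → E) :
    HasDerivAt (fun t => ∑ k, φ (Function.update w i t k) • v k) (φ' • v i) (w i) := by
  have key : ∀ t, ∑ k, φ (Function.update w i t k) • v k =
      φ t • v i + ∑ k ∈ Finset.univ.erase i, φ (w k) • v k := fun t => by
    rw [← Finset.add_sum_erase _ _ (Finset.mem_univ i), Function.update_self]
    congr 1
    refine Finset.sum_congr rfl fun k hk => ?_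
    rw [Function.update_of_ne (Finset.ne_of_mem_erase hk)]
  simp only [key]
  exact (hφ.smul_const (v i)).add_const _

/-- **Theorem 1 (DaMSTF).** The partial derivative of an instance weight `w i` on the meta
validation loss equals the negative scaled inner product between the averaged gradient of the
validation losses at the virtually updated parameters and the gradient of the `i`-th training
loss at the current parameters. -/
theorem meta_weight_gradient
    (n B M : ℕ) (hn : 0 < n) (hB : 0 < B) (hM : 0 < M)
    (θ : EuclideanSpace ℝ (Fin n)) (η : ℝ)
    (ℓ : Fin B → EuclideanSpace ℝ (Fin n) → ℝ)
    (g : Fin M → EuclideanSpace ℝ (Fin n) → ℝ)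
    (hℓ : ∀ i, DifferentiableAt ℝ (ℓ i) θ)
    (σ : ℝ → ℝ) (hσ : ∀ t, σ t = (1 + Real.exp (-t))⁻¹)
    (θHat : (Fin B → ℝ) → EuclideanSpace ℝ (Fin n))
    (hθHat : ∀ w : Fin B → ℝ,
      θHat w = θ - (η / B) • ∑ i : Fin B, σ (w i) • gradient (ℓ i) θ)
    (LM : EuclideanSpace ℝ (Fin n) → ℝ)
    (hLM : ∀ θ', LM θ' = (1 / M : ℝ) * ∑ j : Fin M, g j θ')
    (w : Fin B → ℝ)
    (hg : ∀ j, DifferentiableAt ℝ (g j) (θHat w)) :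
    ∀ i : Fin B,
      deriv (fun t : ℝ => LM (θHat (Function.update w i t))) (w i) =
        -(η / B) * (σ (w i) * (1 - σ (w i))) *
          ⟪(1 / M : ℝ) • ∑ j : Fin M, gradient (g j) (θHat w), gradient (ℓ i) θ⟫ := by
  intro i
  obtain rfl : σ = Real.sigmoid := funext hσ
  have hcurve : HasDerivAt (fun t => θHat (Function.update w i t))
      (-((η / B) • (Real.sigmoid (w i) * (1 - Real.sigmoid (w i))) • gradient (ℓ i) θ)) (w i) := by
    simp only [hθHat]
    exact ((hasDerivAt_sum_update_smul w i (Real.hasDerivAt_sigmoid (w i))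
      fun k => gradient (ℓ k) θ).const_smul (η / B : ℝ)).const_sub θ
  have hgrad : HasGradientAt LM ((1 / M : ℝ) • ∑ j : Fin M, gradient (g j) (θHat w))
      (θHat (Function.update w i (w i))) := by
    rw [Function.update_eq_self, funext hLM]
    exact hasGradientAt_const_mul_sum Finset.univ _ fun j _ => hg j
  rw [(hgrad.comp_hasDerivAt_inner hcurve).deriv, inner_neg_right, real_inner_smul_right,
    real_inner_smul_right]
  ring
end

section
/- Let X be a type and let X₁, X₂ be finite sets of elements of X with X₁ nonempty and X₁ ⊆ X₂. Then the HΔH-distance satisfies d(X₁, X₂) = 2 · (|X₂| − |X₁|) / |X₂|, where |·| denotes cardinality interpreted as a real number. -/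
/-- Disagreement of two binary hypotheses on a finite dataset: the fraction of instances on
which they differ (0 if the dataset is empty, by the division-by-zero convention). -/
noncomputable def disag {X : Type*} (S : Finset X) (h₁ h₂ : X → Bool) : ℝ :=
  ((S.filter fun x => h₁ x ≠ h₂ x).card : ℝ) / (S.card : ℝ)

/-- The HΔH-distance between two finite datasets, with hypothesis class all functions
`X → Bool`: twice the supremum of the gaps of disagreements. -/
noncomputable def dHH {X : Type*} (S T : Finset X) : ℝ :=
  2 * sSup {r : ℝ | ∃ h₁ h₂ : X → Bool, r = |disag S h₁ h₂ - disag T h₁ h₂|}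

/-- On a nonempty subset `S` of `T`, disagreements differ by at most the fraction of `T`
outside `S`. -/
theorem abs_disag_sub_disag_le {X : Type*} {S T : Finset X} (hS : S.Nonempty) (hST : S ⊆ T)
    (f g : X → Bool) :
    |disag S f g - disag T f g| ≤ ((T.card : ℝ) - (S.card : ℝ)) / (T.card : ℝ) := by
  have hn : (0 : ℝ) < S.card := by exact_mod_cast hS.card_pos
  have hnm : (S.card : ℝ) ≤ T.card := by exact_mod_cast Finset.card_le_card hST
  have hm : (0 : ℝ) < T.card := hn.trans_le hnm
  have hS_split := Finset.card_filter_add_card_filter_not (s := S) (fun x => f x ≠ g x)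
  have hT_split := Finset.card_filter_add_card_filter_not (s := T) (fun x => f x ≠ g x)
  have hle := Finset.card_le_card (Finset.filter_subset_filter (fun x => f x ≠ g x) hST)
  have hle_not := Finset.card_le_card (Finset.filter_subset_filter (fun x => ¬ f x ≠ g x) hST)
  unfold disag
  generalize (S.filter fun x => f x ≠ g x).card = a at *
  generalize (T.filter fun x => f x ≠ g x).card = b at *
  have hab : (a : ℝ) ≤ b := by exact_mod_cast hle
  have han : (a : ℝ) ≤ S.card := by exact_mod_cast (by omega : a ≤ S.card)
  have hba : (b : ℝ) + S.card ≤ T.card + a := by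
    exact_mod_cast (by omega : b + S.card ≤ T.card + a)
  rw [abs_sub_le_iff]
  constructor
  · rw [div_sub_div _ _ hn.ne' hm.ne', div_le_div_iff₀ (mul_pos hn hm) hm]
    have key : (a : ℝ) * T.card - S.card * b ≤ (T.card - S.card) * S.card := by
      nlinarith [mul_nonneg (sub_nonneg.2 han) (sub_nonneg.2 hnm),
        mul_nonneg hn.le (sub_nonneg.2 hab)]
    nlinarith [mul_le_mul_of_nonneg_right key hm.le]
  · have hdiv : (a : ℝ) / T.card ≤ a / S.card := by gcongr
    calc (b : ℝ) / T.card - a / S.card ≤ b / T.card - a / T.card := by linarith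
      _ = (b - a) / T.card := by rw [sub_div]
      _ ≤ (T.card - S.card) / T.card := by gcongr ?_ / _; linarith

open Classical in
/-- The gap between disagreements on `S ⊆ T` is extremal for the hypotheses that disagree
exactly on `S`. -/
theorem abs_disag_indicator_sub_disag_indicator {X : Type*} {S T : Finset X}
    (hS : S.Nonempty) (hST : S ⊆ T) :
    |disag S (fun x => decide (x ∈ S)) (fun _ => false) -
        disag T (fun x => decide (x ∈ S)) (fun _ => false)| =
      ((T.card : ℝ) - (S.card : ℝ)) / (T.card : ℝ) := by
  have hn : (0 : ℝ) < S.card := by exact_mod_cast hS.card_pos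
  have hnm : (S.card : ℝ) ≤ T.card := by exact_mod_cast Finset.card_le_card hST
  have hm : (0 : ℝ) < T.card := hn.trans_le hnm
  have hfS : (S.filter fun x => decide (x ∈ S) ≠ false) = S := by
    ext x; simp
  have hfT : (T.filter fun x => decide (x ∈ S) ≠ false) = S := by
    ext x; simpa using @hST x
  rw [disag, disag, hfS, hfT, div_self hn.ne', sub_div, div_self hm.ne', abs_of_nonneg]
  exact sub_nonneg.2 ((div_le_one hm).2 hnm)

/-- **Lemma 1 (DaMSTF).** If `X₁` is a nonempty subset of a finite set `X₂`, then
`d(X₁, X₂) = 2 · (|X₂| − |X₁|) / |X₂|`. -/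
theorem dHH_subset_eq {X : Type*} (X₁ X₂ : Finset X)
    (h₁ : X₁.Nonempty) (hsub : X₁ ⊆ X₂) :
    dHH X₁ X₂ = 2 * (((X₂.card : ℝ) - (X₁.card : ℝ)) / (X₂.card : ℝ)) := by
  unfold dHH
  congr 1
  refine IsGreatest.csSup_eq ⟨⟨_, _, (abs_disag_indicator_sub_disag_indicator h₁ hsub).symm⟩, ?_⟩
  rintro _ ⟨f, g, rfl⟩
  exact abs_disag_sub_disag_le h₁ hsub f g
end

section
/- Let X be a type and let X₁, X₂, X₃ be finite sets of elements of X with X₁ nonempty and X₁ ⊆ X₂ ⊆ X₃. Then the HΔH-distances satisfy d(X₂, X₃) ≤ d(X₁, X₃). -/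
/-- For nonempty `S ⊆ T`, the largest gap of disagreements is `1 - |S| / |T|`. -/
theorem isGreatest_abs_disag_sub {X : Type*} {S T : Finset X} (hS : S.Nonempty) (hST : S ⊆ T) :
    IsGreatest {r : ℝ | ∃ h₁ h₂ : X → Bool, r = |disag S h₁ h₂ - disag T h₁ h₂|}
      (1 - (S.card : ℝ) / T.card) := by
  classical
  have hs : (0 : ℝ) < S.card := by exact_mod_cast hS.card_pos
  have hst : (S.card : ℝ) ≤ T.card := by exact_mod_cast Finset.card_le_card hST
  have ht : (0 : ℝ) < T.card := hs.trans_le hst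
  constructor
  · refine ⟨fun x => decide (x ∈ S), fun _ => false, ?_⟩
    have hfS : S.filter (fun x => decide (x ∈ S) ≠ false) = S := by
      ext x; simp
    have hfT : T.filter (fun x => decide (x ∈ S) ≠ false) = S := by
      ext x; simpa using @hST x
    rw [disag, disag, hfS, hfT, div_self hs.ne', abs_of_nonneg]
    exact sub_nonneg.2 ((div_le_one ht).2 hst)
  · rintro r ⟨h₁, h₂, rfl⟩
    unfold disag
    set A := S.filter fun x => h₁ x ≠ h₂ x with hA
    set B := T.filter fun x => h₁ x ≠ h₂ x with hB
    have hAS : (A.card : ℝ) ≤ S.card := by exact_mod_cast Finset.card_filter_le _ _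
    have hAB : (A.card : ℝ) ≤ B.card := by
      exact_mod_cast Finset.card_le_card (Finset.filter_subset_filter _ hST)
    have hBT : (B.card : ℝ) + S.card ≤ A.card + T.card := by
      have hinter : B ∩ S = A := by
        ext x
        have := @hST x
        simp only [hA, hB, Finset.mem_inter, Finset.mem_filter]
        tauto
      have hunion : (B ∪ S).card ≤ T.card :=
        Finset.card_le_card (Finset.union_subset (Finset.filter_subset _ _) hST)
      have := Finset.card_union_add_card_inter B S
      rw [hinter] at this
      exact_mod_cast (by omega : B.card + S.card ≤ A.card + T.card)
    have hA₀ : (0 : ℝ) ≤ A.card := Nat.cast_nonneg _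
    rw [abs_le, neg_le_sub_iff_le_add, sub_le_iff_le_add]
    constructor
    · have h1 : (B.card : ℝ) / T.card ≤ (A.card + T.card - S.card) / T.card := by
        gcongr; linarith
      have h2 : (A.card : ℝ) / T.card ≤ A.card / S.card := by gcongr
      rw [sub_div, add_div, div_self ht.ne'] at h1
      linarith
    · have h1 : (A.card : ℝ) / T.card ≤ B.card / T.card := by gcongr
      have h2 : ((S.card : ℝ) - A.card) / T.card ≤ (S.card - A.card) / S.card := by
        gcongr
      rw [sub_div, sub_div, div_self hs.ne'] at h2
      linarith

/-- **Theorem 3 (DaMSTF).** If `X₁ ⊆ X₂ ⊆ X₃` with `X₁` nonempty, then enlarging the smaller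
set does not increase its HΔH-distance to the larger set: `d(X₂, X₃) ≤ d(X₁, X₃)`. -/
theorem dHH_mono {X : Type*} (X₁ X₂ X₃ : Finset X)
    (hne : X₁.Nonempty) (h12 : X₁ ⊆ X₂) (h23 : X₂ ⊆ X₃) :
    dHH X₂ X₃ ≤ dHH X₁ X₃ := by
  rw [dHH, dHH, (isGreatest_abs_disag_sub (hne.mono h12) h23).csSup_eq,
    (isGreatest_abs_disag_sub hne (h12.trans h23)).csSup_eq]
  gcongr
end

section
/- Let X be a type, let T be a nonempty finite set of elements of X (the target domain), let S and E be disjoint finite sets of elements of X (the in-domain labeled set and the expansion set of pseudo-labeled instances) with S ∪ E ⊆ T, E nonempty, and let h, h*, g : X → Bool be binary hypotheses (the current hypothesis h = hᵗ, the ideal hypothesis h* giving the ground-truth labels on the target domain, and the previous-iteration hypothesis g = hᵗ⁻¹ providing the pseudo labels on E). Define the mixed empirical error of h on S ∪ E as errSE(h) = (|{x ∈ S : h x ≠ h* x}| + |{x ∈ E : h x ≠ g x}|) / (|S| + |E|), a real number. Then ε_T(h, h*) ≤ errSE(h) + (1/2) · d(S ∪ E, T) + (|E| / (|S| + |E|))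 · ε_E(h*, g), where cardinalities are interpreted as real numbers. -/
theorem disag_nonneg {X : Type*} (S : Finset X) (h₁ h₂ : X → Bool) : 0 ≤ disag S h₁ h₂ := by
  unfold disag
  positivity

theorem disag_le_one {X : Type*} (S : Finset X) (h₁ h₂ : X → Bool) : disag S h₁ h₂ ≤ 1 :=
  div_le_one_of_le₀ (by exact_mod_cast Finset.card_filter_le _ _) (by positivity)

theorem abs_disag_sub_le_half_dHH {X : Type*} (S T : Finset X) (h₁ h₂ : X → Bool) :
    |disag S h₁ h₂ - disag T h₁ h₂| ≤ (1 / 2) * dHH S T := by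
  have hbdd : BddAbove {r : ℝ | ∃ h₁ h₂ : X → Bool, r = |disag S h₁ h₂ - disag T h₁ h₂|} := by
    refine ⟨1, ?_⟩
    rintro r ⟨h₁, h₂, rfl⟩
    rw [abs_le]
    constructor <;>
      linarith [disag_nonneg S h₁ h₂, disag_nonneg T h₁ h₂, disag_le_one S h₁ h₂,
        disag_le_one T h₁ h₂]
  have hle := le_csSup hbdd ⟨h₁, h₂, rfl⟩
  unfold dHH
  linarith

theorem card_filter_ne_triangle {X : Type*} (E : Finset X) (h₁ h₂ h₃ : X → Bool) :
    (E.filter fun x => h₁ x ≠ h₂ x).card ≤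
      (E.filter fun x => h₁ x ≠ h₃ x).card + (E.filter fun x => h₂ x ≠ h₃ x).card := by
  classical
  refine (Finset.card_le_card fun x hx => ?_).trans (Finset.card_union_le _ _)
  simp only [Finset.mem_union, Finset.mem_filter] at hx ⊢
  grind

/-- **Theorem 2 (DaMSTF).** The error rate of the current hypothesis `h` on the target domain
`T` is upper bounded by its mixed empirical error on the meta validation set `S ∪ E`
(ground-truth labels `h*` on `S`, pseudo labels `g` on `E`), plus half the HΔH-distance between
`S ∪ E` and `T`, plus `ρ = |E| / (|S| + |E|)` times the pseudo-label error rate on `E`. -/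
theorem target_error_bound {X : Type*} [DecidableEq X]
    (T S E : Finset X) (hT : T.Nonempty) (hE : E.Nonempty)
    (hdisj : Disjoint S E) (hsub : S ∪ E ⊆ T)
    (h hstar g : X → Bool)
    (errSE : ℝ)
    (herrSE : errSE =
      (((S.filter fun x => h x ≠ hstar x).card : ℝ) +
        ((E.filter fun x => h x ≠ g x).card : ℝ)) / ((S.card : ℝ) + (E.card : ℝ))) :
    disag T h hstar ≤
      errSE + (1 / 2) * dHH (S ∪ E) T +
        ((E.card : ℝ) / ((S.card : ℝ) + (E.card : ℝ))) * disag E hstar g := by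
  have hE0 : (0 : ℝ) < E.card := by exact_mod_cast hE.card_pos
  have hgap := (abs_le.mp (abs_disag_sub_le_half_dHH (S ∪ E) T h hstar)).1
  have hrate : (E.card : ℝ) / ((S.card : ℝ) + E.card) * disag E hstar g =
      ((E.filter fun x => hstar x ≠ g x).card : ℝ) / ((S.card : ℝ) + E.card) := by
    unfold disag
    field_simp
  have hunion : disag (S ∪ E) h hstar =
      (((S.filter fun x => h x ≠ hstar x).card : ℝ) +
        (E.filter fun x => h x ≠ hstar x).card) / ((S.card : ℝ) + E.card) := by
    unfold disag
    rw [Finset.filter_union, Finset.card_union_of_disjoint hdisj,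
      Finset.card_union_of_disjoint (Finset.disjoint_filter_filter hdisj)]
    push_cast
    rfl
  have hmeta : disag (S ∪ E) h hstar ≤
      errSE + (E.card : ℝ) / ((S.card : ℝ) + E.card) * disag E hstar g := by
    have htri : ((E.filter fun x => h x ≠ hstar x).card : ℝ) ≤
        (E.filter fun x => h x ≠ g x).card + (E.filter fun x => hstar x ≠ g x).card := by
      exact_mod_cast card_filter_ne_triangle E h hstar g
    rw [hunion, hrate, herrSE, ← add_div]
    gcongr ?_ / _
    linarith
  linarith
end
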